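/- Let K ⊆ ℝᵐ be a nonempty compact set and let F = {x ∈ K : max_i x_i ≤ max_i y_i for all y ∈ K} be the set of min-max points of K. Then there exists a point x* ∈ F that is Pareto optimal in K; consequently the set of Pareto-optimal min-max points is nonempty. -/

import Mathlib

noncomputable def maxCoord {m : ℕ} (hm : 0 < m) (x : Fin m → ℝ) : ℝ :=
  Finset.univ.sup' (Finset.univ_nonempty_iff.mpr (Fin.pos_iff_nonempty.mp hm)) x

theorem continuous_maxCoord {m : ℕ} (hm : 0 < m) : Continuous (maxCoord hm) :=
  Continuous.finset_sup'_apply _ fun i _ => continuous_apply i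

theorem maxCoord_mono {m : ℕ} (hm : 0 < m) : Monotone (maxCoord hm) :=
  fun _ _ h => Finset.sup'_mono_fun fun i _ => h i

theorem exists_pareto_minmax_point (m : ℕ) (hm : 0 < m) (K : Set (Fin m → ℝ))
    (hK : IsCompact K) (hne : K.Nonempty) :
    ∃ x ∈ K, (∀ y ∈ K, maxCoord hm x ≤ maxCoord hm y) ∧
      ¬ ∃ y ∈ K, (∀ i, y i ≤ x i) ∧ ∃ j, y j < x j := by
  obtain ⟨z, hzK, hz⟩ := hK.exists_isMinOn hne (continuous_maxCoord hm).continuousOn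
  have hF : IsCompact (K ∩ {x | maxCoord hm x ≤ maxCoord hm z}) :=
    hK.inter_right (isClosed_le (continuous_maxCoord hm) continuous_const)
  have hsum : Continuous fun x : Fin m → ℝ => ∑ i, x i := by fun_prop
  obtain ⟨x, ⟨hxK, hxz⟩, hx⟩ := hF.exists_isMinOn ⟨z, hzK, le_refl (maxCoord hm z)⟩ hsum.continuousOn
  refine ⟨x, hxK, fun y hy => le_trans hxz (hz hy), ?_⟩
  rintro ⟨y, hyK, hyx, j, hj⟩
  have hle : ∑ i, x i ≤ ∑ i, y i := hx ⟨hyK, (maxCoord_mono hm hyx).trans hxz⟩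
  exact hle.not_gt (Finset.sum_lt_sum (fun i _ => hyx i) ⟨j, Finset.mem_univ j, hj⟩)
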